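/- Let G be a finite simple graph on N vertices with adjacency matrix A, degree matrix D = diag(d_1,…,d_N), and identity matrix I. Suppose κ ∈ ℝ with κ ≠ 0 and v : V × V → ℝ satisfy the non-backtracking eigen-equation: for every ordered pair (i,j) with a_{ij} = 1, κ·v(i,j) = Σ_{k : a_{jk}=1, k ≠ i} v(j,k). Let x_i = Σ_{j : a_{ij}=1} v(i,j) be the outgoing centralities and let x = (x_1,…,x_N)ᵀ. Then the 2N-dimensional vector z = (x | (1/κ)x)ᵀ satisfies M z = κ z, where M is the 2N × 2N block matrix M = [[A, I − D],[I, 0]]. Equivalently, for every vertex i: Σ_{j=1}^N a_{ij} x_j = (d_i/κ + (κ² − 1)/κ)·x_i. -/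

import Mathlib

open Finset

/-- For a finite simple graph with adjacency matrix `A`, if `(κ, v)` (`κ ≠ 0`) satisfies
the non-backtracking eigen-equation and `x` is the vector of outgoing centralities,
then `z = (x | (1/κ)x)` satisfies `M z = κ z` for the Ihara matrix
`M = [[A, I - D], [I, 0]]`; equivalently `∑ j a_{ij} x_j = (d_i/κ + (κ²-1)/κ) x_i`. -/
theorem nbc_ihara_eigen (N : ℕ) (A : Matrix (Fin N) (Fin N) ℝ)
    (hA01 : ∀ i j, A i j = 0 ∨ A i j = 1)
    (hSymm : ∀ i j, A i j = A j i)
    (hDiag : ∀ i, A i i = 0)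
    (κ : ℝ) (hκ : κ ≠ 0) (v : Fin N → Fin N → ℝ)
    (heig : ∀ i j, A i j = 1 →
      κ * v i j = ∑ k, if A j k = 1 ∧ k ≠ i then v j k else 0)
    (d x : Fin N → ℝ)
    (hd : ∀ i, d i = ∑ j, A i j)
    (hx : ∀ i, x i = ∑ j, if A i j = 1 then v i j else 0)
    (M : Matrix (Fin N ⊕ Fin N) (Fin N ⊕ Fin N) ℝ)
    (hM : M = Matrix.fromBlocks A (1 - Matrix.diagonal d) 1 0)
    (z : Fin N ⊕ Fin N → ℝ)
    (hz : z = Sum.elim x (fun i => x i / κ)) :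
    M.mulVec z = κ • z ∧
      ∀ i, (∑ j, A i j * x j) = (d i / κ + (κ ^ 2 - 1) / κ) * x i := by
  have hx' : ∀ i, x i = ∑ j, A i j * v i j := by
    intro i
    rw [hx]
    refine Finset.sum_congr rfl fun j _ => ?_
    rcases hA01 i j with h | h <;> simp [h]
  have hedge : ∀ i j, A i j = 1 → κ * v i j = x j - v j i := by
    intro i j h
    have hji : A j i = 1 := hSymm i j ▸ h
    rw [heig i j h, hx j, eq_sub_iff_add_eq,
      ← Finset.add_sum_erase _ _ (Finset.mem_univ i),
      ← Finset.add_sum_erase (f := fun k => if A j k = 1 then v j k else 0) _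
        (Finset.mem_univ i)]
    have hsum : ∑ k ∈ univ.erase i, (if A j k = 1 ∧ k ≠ i then v j k else 0) =
        ∑ k ∈ univ.erase i, if A j k = 1 then v j k else 0 :=
      Finset.sum_congr rfl fun k hk => by simp [Finset.ne_of_mem_erase hk]
    rw [hsum]
    simp [hji, add_comm]
  have hout : ∀ i, κ * x i = ∑ j, A i j * x j - ∑ j, A i j * v j i := by
    intro i
    rw [hx' i, Finset.mul_sum, ← Finset.sum_sub_distrib]
    refine Finset.sum_congr rfl fun j _ => ?_
    rcases hA01 i j with h | h
    · simp [h]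
    · simp [h, hedge i j h]
  have hin : ∀ i, κ * ∑ j, A i j * v j i = d i * x i - x i := by
    intro i
    nth_rewrite 2 [hx' i]
    rw [hd i, Finset.mul_sum, Finset.sum_mul, ← Finset.sum_sub_distrib]
    refine Finset.sum_congr rfl fun j _ => ?_
    rcases hA01 i j with h | h
    · simp [h]
    · simp [h, hedge j i (hSymm i j ▸ h)]
  have hmain : ∀ i, ∑ j, A i j * x j = (d i / κ + (κ ^ 2 - 1) / κ) * x i := by
    intro i
    field_simp
    linear_combination hin i - κ * hout i
  refine ⟨?_, hmain⟩
  subst hM hz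
  rw [Matrix.fromBlocks_mulVec]
  ext (i | i)
  · have h := hmain i
    simp only [Sum.elim_comp_inl, Sum.elim_comp_inr, Sum.elim_inl, Pi.add_apply, Pi.smul_apply,
      smul_eq_mul, Matrix.sub_mulVec, Matrix.one_mulVec, Pi.sub_apply, Matrix.mulVec_diagonal]
    rw [Matrix.mulVec, dotProduct, h]
    field_simp
    ring
  · simp [mul_div_cancel₀ _ hκ]
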